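/- arXiv:2006.02621 — 5 statements merged into one kernel-verified Lean document; each statement's English description precedes it below -/
import Mathlib

section
/- Let θ ∈ (0,2π) be such that cos θ is transcendental over ℚ. Then the set of points ξ ∈ 𝔠_θ for which the holonomy representation ρ_ξ is faithful — i.e., for every w ∈ F₂ with w ≠ 1 one has w(A_ξ, B_ξ) ≠ I and w(A_ξ, B_ξ) ≠ −I — contains a dense G_δ subset of 𝔠_θ (in the subspace topology). -/
/-- `SL(2,ℝ)`. -/
abbrev SL2R := Matrix.SpecialLinearGroup (Fin 2) ℝ

/-- The free group `F₂` on two generators. -/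
abbrev F2 := FreeGroup Bool

/-- The generator `X` of `F₂`. -/
def Xg : F2 := FreeGroup.of true

/-- The generator `Y` of `F₂`. -/
def Yg : F2 := FreeGroup.of false

/-- For `z > 2`, the unique real `ζ ≥ 1` with `ζ + ζ⁻¹ = z` (junk value `1` otherwise). -/
noncomputable def zetaOf (z : ℝ) : ℝ :=
  if 2 < z then (z + Real.sqrt (z ^ 2 - 4)) / 2 else 1

lemma zetaOf_ne_zero (z : ℝ) : zetaOf z ≠ 0 := by
  unfold zetaOf
  split_ifs with h
  · have h4 : (0:ℝ) ≤ Real.sqrt (z ^ 2 - 4) := Real.sqrt_nonneg _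
    have : 0 < (z + Real.sqrt (z ^ 2 - 4)) / 2 := by nlinarith
    exact ne_of_gt this
  · norm_num

/-- The normal-form matrix `A_ξ = [[x,−1],[1,0]]` as an element of `SL(2,ℝ)`. -/
noncomputable def Amat (x : ℝ) : SL2R :=
  ⟨!![x, -1; 1, 0], by simp [Matrix.det_fin_two_of]⟩

/-- The normal-form matrix `B_ξ = [[0,ζ⁻¹],[−ζ,y]]` as an element of `SL(2,ℝ)`. -/
noncomputable def Bmat (y z : ℝ) : SL2R :=
  ⟨!![0, (zetaOf z)⁻¹; -(zetaOf z), y], by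
    simp [Matrix.det_fin_two_of]
    exact inv_mul_cancel₀ (zetaOf_ne_zero z)⟩

/-- Evaluation of words: the homomorphism `F₂ → SL(2,ℝ)` sending `X ↦ A`, `Y ↦ B`. -/
noncomputable def ev (A B : SL2R) : F2 →* SL2R :=
  FreeGroup.lift (fun b => if b then A else B)

/-- The (lifted) holonomy representation of `ξ = (x,y,z)`: `w ↦ w(A_ξ, B_ξ)`. -/
noncomputable def rho (ξ : ℝ × ℝ × ℝ) : F2 →* SL2R :=
  ev (Amat ξ.1) (Bmat ξ.2.1 ξ.2.2)

/-- The Fricke–Klein space `𝔠_θ`. -/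
def FK (θ : ℝ) : Set (ℝ × ℝ × ℝ) :=
  {p | 2 < p.1 ∧ 2 < p.2.1 ∧ 2 < p.2.2 ∧
    p.1 ^ 2 + p.2.1 ^ 2 + p.2.2 ^ 2 - p.1 * p.2.1 * p.2.2 - 2 = -2 * Real.cos (θ / 2)}

/-- The full Fricke–Klein space `𝔠`. -/
def FKall : Set (ℝ × ℝ × ℝ) :=
  {p | 2 < p.1 ∧ 2 < p.2.1 ∧ 2 < p.2.2 ∧
    -2 < p.1 ^ 2 + p.2.1 ^ 2 + p.2.2 ^ 2 - p.1 * p.2.1 * p.2.2 - 2 ∧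
    p.1 ^ 2 + p.2.1 ^ 2 + p.2.2 ^ 2 - p.1 * p.2.1 * p.2.2 - 2 < 2}

/-- Trace of an element of `SL(2,ℝ)`. -/
noncomputable def trSL (A : SL2R) : ℝ := Matrix.trace (A : Matrix (Fin 2) (Fin 2) ℝ)

open Polynomial in
/-- Evaluation at a transcendental number embeds the rational function field. -/
lemma exists_ratFunc_hom {ζ : ℝ} (hζ : Transcendental ℚ ζ) :
    ∃ f : RatFunc ℚ →+* ℝ, f RatFunc.X = ζ ∧ ∀ q : ℚ, f (RatFunc.C q) = q := by
  have hinj : Function.Injective (aeval ζ : ℚ[X] →ₐ[ℚ] ℝ).toRingHom :=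
    transcendental_iff_injective.1 hζ
  refine ⟨RatFunc.liftRingHom (aeval ζ : ℚ[X] →ₐ[ℚ] ℝ).toRingHom
    (nonZeroDivisors_le_comap_nonZeroDivisors_of_injective _ hinj), ?_, fun q => ?_⟩ <;> simp

/-- The normal-form matrix `[[x,−1],[1,0]]` over a field. -/
def firstGen {K : Type*} [Field K] (x : K) : Matrix.SpecialLinearGroup (Fin 2) K :=
  ⟨!![x, -1; 1, 0], by simp [Matrix.det_fin_two_of]⟩

/-- The normal-form matrix `[[0,ζ⁻¹],[−ζ,y]]` over a field. -/
def secondGen {K : Type*} [Field K] (y ζ : K) (hζ : ζ ≠ 0) :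
    Matrix.SpecialLinearGroup (Fin 2) K :=
  ⟨!![0, ζ⁻¹; -ζ, y], by simp [Matrix.det_fin_two_of, hζ]⟩

/-- The normal-form representation of the free group over a field. -/
def normalFormRep {K : Type*} [Field K] (x y ζ : K) (hζ : ζ ≠ 0) :
    F2 →* Matrix.SpecialLinearGroup (Fin 2) K :=
  FreeGroup.lift fun b => if b then firstGen x else secondGen y ζ hζ

lemma rho_eq_normalFormRep (ξ : ℝ × ℝ × ℝ) :
    rho ξ = normalFormRep ξ.1 ξ.2.1 (zetaOf ξ.2.2) (zetaOf_ne_zero _) := rfl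

lemma map_comp_normalFormRep {K L : Type*} [Field K] [Field L] (f : K →+* L) (x y ζ : K)
    (hζ : ζ ≠ 0) :
    (Matrix.SpecialLinearGroup.map f).comp (normalFormRep x y ζ hζ) =
      normalFormRep (f x) (f y) (f ζ) ((map_ne_zero f).2 hζ) := by
  have hmap (A : Matrix.SpecialLinearGroup (Fin 2) K) (i j : Fin 2) :
      Matrix.SpecialLinearGroup.map f A i j = f (A i j) := rfl
  ext b i j
  rw [MonoidHom.comp_apply, hmap]
  cases b <;> fin_cases i <;> fin_cases j <;> simp [normalFormRep, firstGen, secondGen]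

lemma injective_normalFormRep_map_iff {K L : Type*} [Field K] [Field L] (f : K →+* L)
    (x y ζ : K) (hζ : ζ ≠ 0) :
    Function.Injective (normalFormRep (f x) (f y) (f ζ) ((map_ne_zero f).2 hζ)) ↔
      Function.Injective (normalFormRep x y ζ hζ) := by
  have hf : Function.Injective (Matrix.SpecialLinearGroup.map (n := Fin 2) f) := by
    intro A B h
    ext i j
    apply f.injective
    simpa using congrArg (fun M : Matrix.SpecialLinearGroup (Fin 2) L => M i j) h
  rw [← map_comp_normalFormRep, MonoidHom.coe_comp]
  exact hf.of_comp_iff _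

lemma repelling_to_attracting {x p q : ℝ} (hx : 2 < x) (h0 : p ≠ 0 ∨ q ≠ 0)
    (h : ¬(0 < p * q ∧ p ^ 2 < q ^ 2)) :
    0 ≤ (x * p - q) * p ∧ p ^ 2 < (x * p - q) ^ 2 := by
  rcases eq_or_ne p 0 with rfl | hp
  · have hq : q ≠ 0 := by simpa using h0
    simp; positivity
  have hp2 : 0 < p ^ 2 := by positivity
  have hpq : p * q ≤ p ^ 2 := by
    by_contra! hlt
    exact h ⟨by linarith, by nlinarith [sq_nonneg (p - q)]⟩
  have key : p ^ 2 < (x * p - q) * p := by nlinarith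
  refine ⟨by linarith, ?_⟩
  nlinarith [sq_nonneg (x * p - q - p)]

lemma attracting_to_repelling {x p q : ℝ} (hx : 2 < x) (h0 : p ≠ 0 ∨ q ≠ 0)
    (h : ¬(0 ≤ p * q ∧ q ^ 2 < p ^ 2)) :
    0 < q * (x * q - p) ∧ q ^ 2 < (x * q - p) ^ 2 := by
  have hq : q ≠ 0 := by
    rintro rfl
    have hp : p ≠ 0 := by simpa using h0
    exact h ⟨by simp, by simp; positivity⟩
  have hq2 : 0 < q ^ 2 := by positivity
  have hpq : p * q ≤ q ^ 2 := by
    by_contra! hlt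
    exact h ⟨by linarith, by nlinarith [sq_nonneg (p - q)]⟩
  have key : q ^ 2 < q * (x * q - p) := by nlinarith
  refine ⟨by linarith, ?_⟩
  nlinarith [sq_nonneg (x * q - p - q)]

/-- The invariant set of nonzero vectors of the plane. -/
def nonzeroVectors : SubMulAction SL2R (Fin 2 → ℝ) where
  carrier := {0}ᶜ
  smul_mem' g _ hv := (smul_ne_zero_iff_ne g).2 hv

lemma nonzeroVectors_coord_ne_zero (v : nonzeroVectors) : v.1 0 ≠ 0 ∨ v.1 1 ≠ 0 := by
  by_contra! h
  exact v.2 (by ext i; fin_cases i <;> simp [h])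

lemma smul_nonzeroVectors_apply (g : SL2R) (v : nonzeroVectors) (i : Fin 2) :
    (g • v).1 i = g i 0 * v.1 0 + g i 1 * v.1 1 := by
  change (g.1.mulVec v.1) i = _
  simp [Matrix.mulVec, dotProduct]

lemma inv_smul_nonzeroVectors (g : SL2R) (v : nonzeroVectors) :
    (g⁻¹ • v).1 0 = g 1 1 * v.1 0 - g 0 1 * v.1 1 ∧
      (g⁻¹ • v).1 1 = g 0 0 * v.1 1 - g 1 0 * v.1 0 := by
  have h0 : (g⁻¹).1 = !![g 1 1, -g 0 1; -g 1 0, g 0 0] := by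
    rw [Matrix.SpecialLinearGroup.coe_inv, Matrix.adjugate_fin_two]
  simp only [smul_nonzeroVectors_apply, h0]
  constructor <;> simp <;> ring

lemma firstGen_smul (x : ℝ) (v : nonzeroVectors) :
    (firstGen x • v).1 0 = x * v.1 0 - v.1 1 ∧ (firstGen x • v).1 1 = v.1 0 := by
  rw [smul_nonzeroVectors_apply, smul_nonzeroVectors_apply]
  simp [firstGen, sub_eq_add_neg]

lemma firstGen_inv_smul (x : ℝ) (v : nonzeroVectors) :
    ((firstGen x)⁻¹ • v).1 0 = v.1 1 ∧ ((firstGen x)⁻¹ • v).1 1 = x * v.1 1 - v.1 0 := by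
  rw [(inv_smul_nonzeroVectors _ v).1, (inv_smul_nonzeroVectors _ v).2]
  simp [firstGen]

lemma secondGen_smul (y ζ : ℝ) (hζ : ζ ≠ 0) (v : nonzeroVectors) :
    (secondGen y ζ hζ • v).1 0 = ζ⁻¹ * v.1 1 ∧
      (secondGen y ζ hζ • v).1 1 = y * v.1 1 - ζ * v.1 0 := by
  rw [smul_nonzeroVectors_apply, smul_nonzeroVectors_apply]
  simp [secondGen]; ring

lemma secondGen_inv_smul (y ζ : ℝ) (hζ : ζ ≠ 0) (v : nonzeroVectors) :
    ((secondGen y ζ hζ)⁻¹ • v).1 0 = y * v.1 0 - ζ⁻¹ * v.1 1 ∧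
      ((secondGen y ζ hζ)⁻¹ • v).1 1 = ζ * v.1 0 := by
  rw [(inv_smul_nonzeroVectors _ v).1, (inv_smul_nonzeroVectors _ v).2]
  simp [secondGen]

open scoped Pointwise in
/-- Ping-pong: the fixed points of the generators are separated when the off-diagonal parameter
of the second one is negative. -/
lemma injective_normalFormRep_neg {x y ζ : ℝ} (hx : 2 < x) (hy : 2 < y) (hζ : 0 < ζ) :
    Function.Injective (normalFormRep x y (-ζ) (neg_ne_zero.2 hζ.ne')) := by
  let X : Bool → Set nonzeroVectors := fun b =>
    if b then {v | 0 ≤ v.1 0 * v.1 1 ∧ v.1 1 ^ 2 < v.1 0 ^ 2}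
    else {v | v.1 0 * v.1 1 ≤ 0 ∧ (ζ * v.1 0) ^ 2 < v.1 1 ^ 2}
  let Y : Bool → Set nonzeroVectors := fun b =>
    if b then {v | 0 < v.1 0 * v.1 1 ∧ v.1 0 ^ 2 < v.1 1 ^ 2}
    else {v | v.1 0 * v.1 1 < 0 ∧ v.1 1 ^ 2 < (ζ * v.1 0) ^ 2}
  have sq_lt_absurd {p q : ℝ} (h : 0 ≤ p * q) (h' : p * q ≤ 0) (h1 : q ^ 2 < p ^ 2)
      (h2 : (ζ * p) ^ 2 < q ^ 2) : False := by
    rcases mul_eq_zero.1 (le_antisymm h' h) with rfl | rfl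
    · nlinarith [sq_nonneg q]
    · nlinarith [sq_nonneg (ζ * p)]
  refine FreeGroup.injective_lift_of_ping_pong _ X Y ?_ ?_ ?_ ?_ ?_ ?_
  · rintro (_ | _)
    · exact ⟨⟨![0, 1], fun h => by simpa using congrFun h 1⟩, by simp [X]⟩
    · exact ⟨⟨![1, 0], fun h => by simpa using congrFun h 0⟩, by simp [X]⟩
  · rintro (_ | _) (_ | _) hij <;> first | exact absurd rfl hij | skip
    · exact Set.disjoint_left.2 fun v h1 h2 => sq_lt_absurd h2.1 h1.1 h2.2 h1.2
    · exact Set.disjoint_left.2 fun v h1 h2 => sq_lt_absurd h1.1 h2.1 h1.2 h2.2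
  · rintro (_ | _) (_ | _) hij <;> first | exact absurd rfl hij | skip
    · exact Set.disjoint_left.2 fun v h1 h2 => lt_asymm h1.1 h2.1
    · exact Set.disjoint_left.2 fun v h1 h2 => lt_asymm h1.1 h2.1
  · rintro (_ | _) (_ | _)
    · exact Set.disjoint_left.2 fun v h1 h2 => lt_asymm h1.2 h2.2
    · exact Set.disjoint_left.2 fun v h1 h2 => h1.1.not_gt h2.1
    · exact Set.disjoint_left.2 fun v h1 h2 => h1.1.not_gt h2.1
    · exact Set.disjoint_left.2 fun v h1 h2 => lt_asymm h1.2 h2.2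
  · rintro (_ | _) _ ⟨v, hv, rfl⟩
    · have h := repelling_to_attracting (p := v.1 1) (q := -(ζ * v.1 0)) hy
        (by simpa [hζ.ne', or_comm] using nonzeroVectors_coord_ne_zero v)
        (fun h => hv ⟨by nlinarith [h.1], by nlinarith [h.2]⟩)
      obtain ⟨e0, e1⟩ := secondGen_smul y (-ζ) (neg_ne_zero.2 hζ.ne') v
      have e0' : ζ * (secondGen y (-ζ) (neg_ne_zero.2 hζ.ne') • v).1 0 = -v.1 1 := by
        rw [e0]; field_simp
      refine ⟨nonpos_of_mul_nonpos_right ?_ hζ, ?_⟩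
      · beta_reduce
        rw [if_neg Bool.false_ne_true, ← mul_assoc, e0', e1]
        linarith [h.1]
      · beta_reduce
        rw [if_neg Bool.false_ne_true, e0', e1]
        nlinarith [h.2]
    · have h := repelling_to_attracting hx (nonzeroVectors_coord_ne_zero v) hv
      obtain ⟨e0, e1⟩ := firstGen_smul x v
      refine ⟨?_, ?_⟩ <;> beta_reduce <;> rw [if_pos rfl, e0, e1]
      exacts [h.1, h.2]
  · rintro (_ | _) _ ⟨v, hv, rfl⟩
    · have h := attracting_to_repelling (p := -v.1 1) (q := ζ * v.1 0) hy
        (by simpa [hζ.ne', or_comm] using nonzeroVectors_coord_ne_zero v)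
        (fun h => hv ⟨by nlinarith [h.1], by nlinarith [h.2]⟩)
      obtain ⟨e0, e1⟩ := secondGen_inv_smul y (-ζ) (neg_ne_zero.2 hζ.ne') v
      have e0' : ζ * ((secondGen y (-ζ) (neg_ne_zero.2 hζ.ne'))⁻¹ • v).1 0 =
          y * (ζ * v.1 0) + v.1 1 := by
        rw [e0]; field_simp; ring
      refine ⟨neg_of_mul_neg_right (a := ζ) ?_ hζ.le, ?_⟩
      · beta_reduce
        rw [Pi.inv_apply, if_neg Bool.false_ne_true, ← mul_assoc, e0', e1]
        linarith [h.1]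
      · beta_reduce
        rw [Pi.inv_apply, if_neg Bool.false_ne_true, e0', e1]
        nlinarith [h.2]
    · have h := attracting_to_repelling hx (nonzeroVectors_coord_ne_zero v) hv
      obtain ⟨e0, e1⟩ := firstGen_inv_smul x v
      refine ⟨?_, ?_⟩ <;> beta_reduce <;> rw [Pi.inv_apply, if_pos rfl, e0, e1]
      exacts [h.1, h.2]

lemma zetaOf_pos {z : ℝ} (hz : 2 < z) : 0 < zetaOf z := by
  rw [zetaOf, if_pos hz]
  positivity

lemma zetaOf_add_inv {z : ℝ} (hz : 2 < z) : zetaOf z + (zetaOf z)⁻¹ = z := by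
  have h := zetaOf_ne_zero z
  have hs : Real.sqrt (z ^ 2 - 4) ^ 2 = z ^ 2 - 4 := Real.sq_sqrt (by nlinarith)
  field_simp
  rw [zetaOf, if_pos hz]
  nlinarith

lemma transcendental_zetaOf {x y : ℚ} {z : ℝ} (hz : 2 < z)
    (ht : Transcendental ℚ ((x : ℝ) ^ 2 + (y : ℝ) ^ 2 + z ^ 2 - x * y * z - 2)) :
    Transcendental ℚ (zetaOf z) := by
  intro h
  have hz' : IsAlgebraic ℚ z := zetaOf_add_inv hz ▸ h.add h.inv
  have hx : IsAlgebraic ℚ (x : ℝ) := isAlgebraic_ratCast ..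
  have hy : IsAlgebraic ℚ (y : ℝ) := isAlgebraic_ratCast ..
  have h2 : IsAlgebraic ℚ (2 : ℝ) := isAlgebraic_natCast 2
  exact ht (((((hx.pow 2).add (hy.pow 2)).add (hz'.pow 2)).sub ((hx.mul hy).mul hz')).sub h2)

lemma injective_rho_of_rat {x y : ℚ} {z : ℝ} (hx : 2 < (x : ℝ)) (hy : 2 < (y : ℝ)) (hz : 2 < z)
    (ht : Transcendental ℚ ((x : ℝ) ^ 2 + (y : ℝ) ^ 2 + z ^ 2 - x * y * z - 2)) :
    Function.Injective (rho (x, y, z)) := by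
  have hζ := transcendental_zetaOf hz ht
  obtain ⟨f, hfX, hfC⟩ := exists_ratFunc_hom hζ
  obtain ⟨g, hgX, hgC⟩ := exists_ratFunc_hom (ζ := -zetaOf z)
    (fun h => hζ (by simpa using h.neg))
  have hf := injective_normalFormRep_map_iff f (RatFunc.C x) (RatFunc.C y) _ RatFunc.X_ne_zero
  have hg := injective_normalFormRep_map_iff g (RatFunc.C x) (RatFunc.C y) _ RatFunc.X_ne_zero
  simp only [hfX, hfC] at hf
  simp only [hgX, hgC] at hg
  rw [rho_eq_normalFormRep]
  exact hf.2 (hg.1 (injective_normalFormRep_neg hx hy (zetaOf_pos hz)))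

lemma transcendental_neg_two_mul_cos_half {θ : ℝ} (h : Transcendental ℚ (Real.cos θ)) :
    Transcendental ℚ (-2 * Real.cos (θ / 2)) := by
  intro ht
  have hc : Real.cos θ = (-2 * Real.cos (θ / 2)) ^ 2 * (2 : ℝ)⁻¹ - 1 := by
    have := Real.cos_two_mul (θ / 2)
    rw [mul_div_cancel₀ θ two_ne_zero] at this
    rw [this]; ring
  have h2 : IsAlgebraic ℚ (2 : ℝ) := isAlgebraic_natCast 2
  exact h (hc ▸ ((ht.pow 2).mul h2.inv).sub isAlgebraic_one)

lemma continuous_rho_apply (θ : ℝ) (w : F2) : Continuous fun ξ : FK θ => rho ξ.1 w := by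
  have hζ : Continuous fun ξ : FK θ => zetaOf ξ.1.2.2 := by
    have h : (fun ξ : FK θ => zetaOf ξ.1.2.2) =
        fun ξ => (ξ.1.2.2 + Real.sqrt (ξ.1.2.2 ^ 2 - 4)) / 2 := by
      ext ξ
      rw [zetaOf, if_pos ξ.2.2.2.1]
    rw [h]
    fun_prop
  have hζ' := hζ.inv₀ fun ξ => zetaOf_ne_zero _
  have hA : Continuous fun ξ : FK θ => Amat ξ.1.1 := by
    refine Continuous.subtype_mk (continuous_matrix fun i j => ?_) _
    fin_cases i <;> fin_cases j <;> simp <;> fun_prop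
  have hB : Continuous fun ξ : FK θ => Bmat ξ.1.2.1 ξ.1.2.2 := by
    refine Continuous.subtype_mk (continuous_matrix fun i j => ?_) _
    fin_cases i <;> fin_cases j <;> simp <;> first | exact hζ' | fun_prop
  induction w using FreeGroup.induction_on with
  | C1 => simpa using continuous_const
  | of b => cases b <;> simpa [rho, ev]
  | inv_of b h => exact h.inv.congr fun ξ => (map_inv (rho ξ.1) _).symm
  | mul v w hv hw => exact (hv.mul hw).congr fun ξ => (map_mul (rho ξ.1) v w).symm

/-- Points of `𝔠_θ` whose first two coordinates are rational are dense. -/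
lemma dense_rat_coords (θ : ℝ) :
    Dense {ξ : FK θ | ∃ x y : ℚ, ξ.1.1 = x ∧ ξ.1.2.1 = y} := by
  rintro ⟨⟨x₀, y₀, z₀⟩, hx₀, hy₀, hz₀, h₀⟩
  dsimp only at hx₀ hy₀ hz₀ h₀
  set t := -2 * Real.cos (θ / 2)
  let D : ℝ × ℝ → ℝ := fun p => p.1 ^ 2 * p.2 ^ 2 - 4 * (p.1 ^ 2 + p.2 ^ 2 - 2 - t)
  have hD₀ : D (x₀, y₀) = (2 * z₀ - x₀ * y₀) ^ 2 := by simp only [D, ← h₀]; ring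
  obtain ⟨s, hs, hs₀⟩ : ∃ s : ℝ, s ^ 2 = 1 ∧ s * Real.sqrt (D (x₀, y₀)) = 2 * z₀ - x₀ * y₀ := by
    rw [hD₀, Real.sqrt_sq_eq_abs]
    rcases abs_choice (2 * z₀ - x₀ * y₀) with h | h
    · exact ⟨1, by norm_num, by rw [h, one_mul]⟩
    · exact ⟨-1, by norm_num, by rw [h]; ring⟩
  let g : ℝ × ℝ → ℝ × ℝ × ℝ := fun p => (p.1, p.2, (p.1 * p.2 + s * Real.sqrt (D p)) / 2)
  have hg : Continuous g := by fun_prop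
  have hg₀ : g (x₀, y₀) = (x₀, y₀, z₀) := by simp only [g, hs₀]; ring_nf
  rw [mem_closure_iff]
  rintro _ ⟨V, hV, rfl⟩ hmem
  have hW : IsOpen (g ⁻¹' (V ∩ {p | 2 < p.2.2})) :=
    (hV.inter (isOpen_lt continuous_const (by fun_prop))).preimage hg
  obtain ⟨ε, hε, hball⟩ := Metric.isOpen_iff.1 hW (x₀, y₀) (by
    rw [Set.mem_preimage, hg₀]; exact ⟨hmem, hz₀⟩)
  obtain ⟨x, hx1, hx2⟩ := exists_rat_btwn (lt_add_of_pos_right x₀ hε)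
  obtain ⟨y, hy1, hy2⟩ := exists_rat_btwn (lt_add_of_pos_right y₀ hε)
  have hxy : ((x : ℝ), (y : ℝ)) ∈ Metric.ball (x₀, y₀) ε := by
    rw [Metric.mem_ball, Prod.dist_eq, max_lt_iff, Real.dist_eq, Real.dist_eq, abs_lt, abs_lt]
    constructor <;> constructor <;> simp only <;> linarith
  have hD : 0 ≤ D (x, y) := by
    have h1 : D (x₀, y₀) ≤ D (x, y₀) := by
      have : 0 ≤ ((x : ℝ) ^ 2 - x₀ ^ 2) * (y₀ ^ 2 - 4) :=
        mul_nonneg (by nlinarith) (by nlinarith)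
      simp only [D]
      linarith
    have h2 : D (x, y₀) ≤ D (x, y) := by
      have : 0 ≤ ((x : ℝ) ^ 2 - 4) * ((y : ℝ) ^ 2 - y₀ ^ 2) :=
        mul_nonneg (by nlinarith) (by nlinarith)
      simp only [D]
      linarith
    linarith [hD₀ ▸ sq_nonneg (2 * z₀ - x₀ * y₀)]
  have hmemg := hball hxy
  refine ⟨⟨g (x, y), hx₀.trans hx1, hy₀.trans hy1, hmemg.2, ?_⟩, hmemg.1, x, y, rfl, rfl⟩
  have hsq : (s * Real.sqrt (D (x, y))) ^ 2 = D (x, y) := by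
    rw [mul_pow, hs, Real.sq_sqrt hD, one_mul]
  simp only [g]
  simp only [D] at hsq ⊢
  linear_combination hsq / 4

/-- If `cos θ` is transcendental for `θ ∈ (0,2π)`, then the set of `ξ ∈ 𝔠_θ`
with `ρ_ξ` faithful contains a dense `G_δ` subset of `𝔠_θ`. -/
theorem stmt_0 (θ : ℝ) (hθ : θ ∈ Set.Ioo 0 (2 * Real.pi))
    (htrans : Transcendental ℚ (Real.cos θ)) :
    ∃ S : Set ↥(FK θ), IsGδ S ∧ Dense S ∧
      ∀ ξ ∈ S, ∀ w : F2, w ≠ 1 →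
        ((rho ξ.1 w : Matrix (Fin 2) (Fin 2) ℝ) ≠ 1 ∧
         (rho ξ.1 w : Matrix (Fin 2) (Fin 2) ℝ) ≠ -1) := by
  refine ⟨⋂ w ∈ {w : F2 | w ≠ 1}, {ξ | rho ξ.1 w ≠ 1}, ?_, ?_, fun ξ hξ w hw => ?_⟩
  · exact .biInter (Set.to_countable _) fun w _ =>
      (isOpen_ne.preimage (continuous_rho_apply θ w)).isGδ
  · refine (dense_rat_coords θ).mono ?_
    rintro ⟨⟨_, _, z⟩, hx, hy, hz, h⟩ ⟨x, y, rfl, rfl⟩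
    have hinj := injective_rho_of_rat hx hy hz
      (by rw [h]; exact transcendental_neg_two_mul_cos_half htrans)
    exact Set.mem_iInter₂.2 fun w hw h1 => hw (hinj (h1.trans (map_one _).symm))
  · rw [Set.mem_iInter₂] at hξ
    refine ⟨fun h => hξ w hw (Subtype.ext h), fun h => hξ (w ^ 2) ?_ (Subtype.ext ?_)⟩
    · simpa using hw
    · rw [map_pow, Matrix.SpecialLinearGroup.coe_pow, h]
      simp
end

section
/- Let θ ∈ (0,2π) be such that cos θ is transcendental over ℚ, let w ∈ F₂ with w ≠ 1, and let c ∈ ℝ be algebraic over ℚ. Then the set {ξ ∈ 𝔠_θ : tr(w(A_ξ, B_ξ)) = c} has empty interior in 𝔠_θ (with its subspace topology). -/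
/-- The matrices `A`, `A⁻¹`, `ζB`, `ζB⁻¹` attached to the letters of `F₂`, over any commutative
ring; scaling by `ζ` makes their entries polynomial in `x, y, ζ`. -/
def letterMat {R : Type*} [CommRing R] (x y s : R) : Bool × Bool → Matrix (Fin 2) (Fin 2) R
  | (true, true) => !![x, -1; 1, 0]
  | (true, false) => !![0, 1; -1, x]
  | (false, true) => !![0, 1; -s ^ 2, y * s]
  | (false, false) => !![y * s, -1; s ^ 2, 0]

/-- The scaling factor of a letter in `letterMat`. -/
def letterScale {R : Type*} [CommRing R] (s : R) : Bool × Bool → R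
  | (true, _) => 1
  | (false, _) => s

/-- The balanced rescaling of `letterMat` for `x = y = ε⁻¹`, `ζ = 2ε⁻²`, as a function of
`δ = ε²`. -/
noncomputable def balancedMat (δ : ℝ) : Bool × Bool → Matrix (Fin 2) (Fin 2) ℝ
  | (true, true) => !![1, -1; δ, 0]
  | (true, false) => !![0, 1; -δ, 1]
  | (false, true) => !![0, δ / 2; -2, 1]
  | (false, false) => !![1, -δ / 2; 2, 0]

/-- The column factor of the rank one matrix `balancedMat 0`. -/
def limitCol : Bool × Bool → Fin 2 → ℝ
  | (true, true) => ![1, 0]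
  | (true, false) => ![1, 1]
  | (false, true) => ![0, 1]
  | (false, false) => ![1, 2]

/-- The row factor of the rank one matrix `balancedMat 0`. -/
def limitRow : Bool × Bool → Fin 2 → ℝ
  | (true, true) => ![1, -1]
  | (true, false) => ![0, 1]
  | (false, true) => ![-2, 1]
  | (false, false) => ![1, 0]

lemma balancedMat_zero (a : Bool × Bool) :
    balancedMat 0 a = Matrix.vecMulVec (limitCol a) (limitRow a) := by
  rcases a with ⟨_ | _, _ | _⟩ <;> ext i j <;> fin_cases i <;> fin_cases j <;>
    simp [balancedMat, limitCol, limitRow, Matrix.vecMulVec]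

lemma limitRow_dotProduct_limitCol_ne_zero {a b : Bool × Bool} (h : a.1 = b.1 → a.2 = b.2) :
    dotProduct (limitRow a) (limitCol b) ≠ 0 := by
  rcases a with ⟨_ | _, _ | _⟩ <;> rcases b with ⟨_ | _, _ | _⟩ <;>
    simp [limitCol, limitRow] at h ⊢ <;> norm_num

lemma exists_prod_balancedMat_zero (a : Bool × Bool) (L : List (Bool × Bool))
    (hL : FreeGroup.IsReduced (a :: L)) :
    ∃ r : ℝ, r ≠ 0 ∧ ((a :: L).map (balancedMat 0)).prod =
      r • Matrix.vecMulVec (limitCol a) (limitRow ((a :: L).getLast (List.cons_ne_nil _ _))) := by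
  induction L generalizing a with
  | nil => exact ⟨1, one_ne_zero, by simp [balancedMat_zero]⟩
  | cons b L ih =>
    rw [FreeGroup.IsReduced, List.isChain_cons_cons] at hL
    obtain ⟨r, hr, h⟩ := ih b hL.2
    refine ⟨r * dotProduct (limitRow a) (limitCol b),
      mul_ne_zero hr (limitRow_dotProduct_limitCol_ne_zero hL.1), ?_⟩
    rw [List.map_cons, List.prod_cons, h, balancedMat_zero, Matrix.mul_smul,
      Matrix.vecMulVec_mul_vecMulVec, List.getLast_cons (List.cons_ne_nil _ _), mul_smul,
      Matrix.vecMulVec_smul]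

lemma trace_prod_balancedMat_zero_ne_zero {L : List (Bool × Bool)} (hne : L ≠ [])
    (hL : FreeGroup.IsCyclicallyReduced L) :
    (L.map (balancedMat 0)).prod.trace ≠ 0 := by
  obtain ⟨a, L, rfl⟩ := List.exists_cons_of_ne_nil hne
  obtain ⟨r, hr, h⟩ := exists_prod_balancedMat_zero a L hL.1
  rw [h, Matrix.trace_smul, Matrix.trace_vecMulVec, dotProduct_comm, smul_eq_mul]
  exact mul_ne_zero hr (limitRow_dotProduct_limitCol_ne_zero
    (hL.2 _ (by simp [List.getLast?_eq_some_getLast]) _ (by simp)))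

lemma mul_prod_map_of_intertwine {R ι n : Type*} [CommRing R] [Fintype n] [DecidableEq n]
    (G : Matrix n n R) (f g : ι → Matrix n n R) (σ : ι → R)
    (h : ∀ a, G * f a = σ a • (g a * G)) (L : List ι) :
    G * (L.map f).prod = (L.map σ).prod • ((L.map g).prod * G) := by
  induction L with
  | nil => simp
  | cons a L ih =>
    rw [List.map_cons, List.prod_cons, ← mul_assoc, h, Matrix.smul_mul, mul_assoc, ih]
    simp [mul_smul, mul_assoc]

lemma continuous_prod_balancedMat (L : List (Bool × Bool)) :
    Continuous fun ε : ℝ => (L.map (balancedMat (ε ^ 2))).prod := by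
  refine continuous_list_prod (f := fun a (ε : ℝ) => balancedMat (ε ^ 2) a) L fun a _ => ?_
  rcases a with ⟨_ | _, _ | _⟩ <;> refine continuous_matrix fun i j => ?_ <;>
    fin_cases i <;> fin_cases j <;> simp [balancedMat] <;> fun_prop

lemma trace_prod_letterMat_eq_balanced (L : List (Bool × Bool)) {ε : ℝ} (hε : ε ≠ 0) :
    ε ^ L.length * (L.map (letterMat ε⁻¹ ε⁻¹ (2 * ε⁻¹ ^ 2))).prod.trace =
      (L.map (letterScale (2 * ε⁻¹ ^ 2))).prod * (L.map (balancedMat (ε ^ 2))).prod.trace := by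
  have h := mul_prod_map_of_intertwine !![1, 0; 0, ε] (letterMat ε⁻¹ ε⁻¹ (2 * ε⁻¹ ^ 2))
    (balancedMat (ε ^ 2)) (fun a => ε⁻¹ * letterScale (2 * ε⁻¹ ^ 2) a) (by
      rintro ⟨_ | _, _ | _⟩ <;> ext i j <;> fin_cases i <;> fin_cases j <;>
        simp [letterMat, balancedMat, letterScale, Matrix.mul_apply, Fin.sum_univ_two] <;>
        field_simp) L
  have hG : IsUnit (!![1, 0; 0, ε] : Matrix (Fin 2) (Fin 2) ℝ).det := by simp [hε]
  have h2 : (L.map (letterMat ε⁻¹ ε⁻¹ (2 * ε⁻¹ ^ 2))).prod.trace =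
      (L.map fun a => ε⁻¹ * letterScale (2 * ε⁻¹ ^ 2) a).prod *
        (L.map (balancedMat (ε ^ 2))).prod.trace := by
    rw [← Matrix.nonsing_inv_mul_cancel_left _ (L.map (letterMat ε⁻¹ ε⁻¹ (2 * ε⁻¹ ^ 2))).prod hG, h,
      Matrix.trace_mul_comm, Matrix.smul_mul, Matrix.mul_nonsing_inv_cancel_right _ _ hG,
      Matrix.trace_smul, smul_eq_mul]
  rw [h2, List.prod_map_mul, List.map_const', List.prod_replicate, ← mul_assoc, ← mul_assoc,
    ← mul_pow, mul_inv_cancel₀ hε, one_pow, one_mul]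

/-- The trace of a nonempty cyclically reduced word is not constant on the normal forms. -/
lemma not_forall_trace_prod_letterMat_eq {L : List (Bool × Bool)} (hne : L ≠ [])
    (hL : FreeGroup.IsCyclicallyReduced L) (c : ℝ) :
    ¬ ∀ x y s : ℝ, (L.map (letterMat x y s)).prod.trace = c * (L.map (letterScale s)).prod := by
  intro h
  have hlen : L.length ≠ 0 := by simpa using hne
  have key : ∀ ε : ℝ, ε ≠ 0 →
      (L.map (balancedMat (ε ^ 2))).prod.trace = c * ε ^ L.length := by
    intro ε hε
    have h1 := trace_prod_letterMat_eq_balanced L hε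
    have hs : (L.map (letterScale (2 * ε⁻¹ ^ 2))).prod ≠ 0 := by
      refine List.prod_ne_zero fun h0 => ?_
      obtain ⟨⟨_ | _, _⟩, _, ha⟩ := List.mem_map.1 h0 <;> simp [letterScale, hε] at ha
    rw [h] at h1
    apply mul_left_cancel₀ hs
    rw [← h1]
    ring
  have hc1 : Continuous fun ε : ℝ => (L.map (balancedMat (ε ^ 2))).prod.trace :=
    (continuous_prod_balancedMat L).matrix_trace
  have hc2 : Continuous fun ε : ℝ => c * ε ^ L.length := by fun_prop
  have heq := Continuous.ext_on (dense_compl_singleton (0 : ℝ)) hc1 hc2 fun ε hε => key ε hε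
  refine trace_prod_balancedMat_zero_ne_zero hne hL ?_
  simpa [hlen] using congrFun heq 0

lemma map_prod_letterMat {R S : Type*} [CommRing R] [CommRing S] (φ : R →+* S) (x y s : R)
    (L : List (Bool × Bool)) :
    φ (L.map (letterMat x y s)).prod.trace =
      (L.map (letterMat (φ x) (φ y) (φ s))).prod.trace := by
  rw [AddMonoidHom.map_trace φ, ← RingHom.mapMatrix_apply, map_list_prod, List.map_map]
  congr 3
  funext a
  rcases a with ⟨_ | _, _ | _⟩ <;> ext i j <;> fin_cases i <;> fin_cases j <;>
    simp [letterMat]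

lemma map_prod_letterScale {R S : Type*} [CommRing R] [CommRing S] (φ : R →+* S) (s : R)
    (L : List (Bool × Bool)) :
    φ (L.map (letterScale s)).prod = (L.map (letterScale (φ s))).prod := by
  rw [map_list_prod, List.map_map]
  congr 2
  funext a
  rcases a with ⟨_ | _, _⟩ <;> simp [letterScale]

lemma trace_prod_letterMat_ne_of_algebraicIndependent {L : List (Bool × Bool)} (hne : L ≠ [])
    (hL : FreeGroup.IsCyclicallyReduced L) {c : ℝ} (hc : IsAlgebraic ℚ c) {x y s : ℝ}
    (hind : AlgebraicIndependent ℚ ![s, x, y]) :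
    (L.map (letterMat x y s)).prod.trace ≠ c * (L.map (letterScale s)).prod := by
  intro h
  have hind' : AlgebraicIndependent (algebraicClosure ℚ ℝ) ![s, x, y] := hind.algebraicClosure
  let c' : algebraicClosure ℚ ℝ := ⟨c, mem_algebraicClosure_iff.2 hc⟩
  let P : MvPolynomial (Fin 3) (algebraicClosure ℚ ℝ) :=
    (L.map (letterMat (.X 1) (.X 2) (.X 0))).prod.trace
      - .C c' * (L.map (letterScale (.X 0))).prod
  have hP : ∀ v : Fin 3 → ℝ, MvPolynomial.aeval v P =
      (L.map (letterMat (v 1) (v 2) (v 0))).prod.trace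
        - c * (L.map (letterScale (v 0))).prod := by
    intro v
    have h1 := map_prod_letterMat (MvPolynomial.aeval (R := algebraicClosure ℚ ℝ) v).toRingHom
      (.X 1) (.X 2) (.X 0) L
    have h2 := map_prod_letterScale (MvPolynomial.aeval (R := algebraicClosure ℚ ℝ) v).toRingHom
      (.X 0) L
    simp only [AlgHom.toRingHom_eq_coe, RingHom.coe_coe, MvPolynomial.aeval_X] at h1 h2
    rw [map_sub, map_mul, h1, h2, MvPolynomial.aeval_C]
    rfl
  have hP0 : P = 0 := by
    refine hind'.eq_zero_of_aeval_eq_zero P ?_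
    rw [hP]
    simpa [sub_eq_zero] using h
  refine not_forall_trace_prod_letterMat_eq hne hL c fun x y s => ?_
  have := hP ![s, x, y]
  rw [hP0, map_zero] at this
  exact (sub_eq_zero.1 this.symm)

lemma algebraicIndependent_cons_iff {n : ℕ} {v : Fin n → ℝ} {a : ℝ} :
    AlgebraicIndependent ℚ (Fin.cons a v : Fin (n + 1) → ℝ) ↔
      AlgebraicIndependent ℚ v ∧ Transcendental (Algebra.adjoin ℚ (Set.range v)) a := by
  rw [← AlgebraicIndependent.option_iff]
  refine algebraicIndependent_equiv' (finSuccEquiv n) ?_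
  funext i
  refine Fin.cases ?_ (fun j => ?_) i <;> simp

lemma dense_setOf_algebraicIndependent_cons {n : ℕ} {v : Fin n → ℝ}
    (hv : AlgebraicIndependent ℚ v) :
    Dense {a : ℝ | AlgebraicIndependent ℚ (Fin.cons a v : Fin (n + 1) → ℝ)} := by
  have hcount : Countable (Algebra.adjoin ℚ (Set.range v)) := by
    have : Countable (MvPolynomial (Fin n) ℚ) := by
      rw [← Cardinal.mk_le_aleph0_iff]
      exact MvPolynomial.cardinalMk_le_max_lift.trans (by simp)
    rw [Algebra.adjoin_range_eq_range_aeval]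
    exact (Set.countable_range (MvPolynomial.aeval (R := ℚ) v)).to_subtype
  have := (Algebraic.countable (Algebra.adjoin ℚ (Set.range v)) ℝ).dense_compl ℝ
  convert this using 1
  ext a
  simp [algebraicIndependent_cons_iff, hv, Transcendental]

/-- Exchange: a new coordinate over which an independent one is algebraic is independent. -/
lemma AlgebraicIndependent.cons_of_isAlgebraic_imp {n : ℕ} {v : Fin n → ℝ} {a b : ℝ}
    (h : AlgebraicIndependent ℚ (Fin.cons a v : Fin (n + 1) → ℝ))
    (hab : IsAlgebraic (Algebra.adjoin ℚ (Set.range v)) b →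
      IsAlgebraic (Algebra.adjoin ℚ (Set.range v)) a) :
    AlgebraicIndependent ℚ (Fin.cons b v : Fin (n + 1) → ℝ) := by
  rw [algebraicIndependent_cons_iff] at h ⊢
  exact ⟨h.1, fun hb => h.2 (hab hb)⟩

lemma isAlgebraic_adjoin_of_mem {s : Set ℝ} {a : ℝ} (ha : a ∈ s) :
    IsAlgebraic (Algebra.adjoin ℚ s) a :=
  isAlgebraic_algebraMap (⟨a, Algebra.subset_adjoin ha⟩ : Algebra.adjoin ℚ s)

/-- Near a point where `κ = t` can be solved for the last coordinate there are points of `κ = t`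
with algebraically independent coordinates, for `t` transcendental. -/
lemma exists_algebraicIndependent_mem {t p₀ q₀ r₀ : ℝ} (ht : Transcendental ℚ t)
    (h₀ : p₀ ^ 2 + q₀ ^ 2 + r₀ ^ 2 - p₀ * q₀ * r₀ - 2 = t) (hne : 2 * r₀ - p₀ * q₀ ≠ 0)
    {V : Set (ℝ × ℝ × ℝ)} (hV : IsOpen V) (hmem : (p₀, q₀, r₀) ∈ V) :
    ∃ p q r : ℝ, (p, q, r) ∈ V ∧ p ^ 2 + q ^ 2 + r ^ 2 - p * q * r - 2 = t ∧
      AlgebraicIndependent ℚ ![r, p, q] := by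
  obtain ⟨σ, hσ, hσe⟩ : ∃ σ : ℝ, σ ^ 2 = 1 ∧ 2 * r₀ - p₀ * q₀ = σ * |2 * r₀ - p₀ * q₀| := by
    rcases abs_choice (2 * r₀ - p₀ * q₀) with h | h
    · exact ⟨1, by norm_num, by rw [h]; ring⟩
    · exact ⟨-1, by norm_num, by rw [h]; ring⟩
  let D : ℝ × ℝ → ℝ := fun u => (u.1 * u.2) ^ 2 - 4 * (u.1 ^ 2 + u.2 ^ 2 - 2 - t)
  have hD : Continuous D := by fun_prop
  let r : ℝ × ℝ → ℝ := fun u => (u.1 * u.2 + σ * √(D u)) / 2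
  have hr : Continuous r := by fun_prop
  have hD₀ : D (p₀, q₀) = (2 * r₀ - p₀ * q₀) ^ 2 := by simp only [D, ← h₀]; ring
  have hr₀ : r (p₀, q₀) = r₀ := by
    simp only [r]
    rw [hD₀, Real.sqrt_sq_eq_abs, ← hσe]
    ring
  have hW : IsOpen {u : ℝ × ℝ | (u.1, u.2, r u) ∈ V ∧ 0 < D u} :=
    (hV.preimage (by fun_prop)).inter (isOpen_lt continuous_const hD)
  obtain ⟨U₁, U₂, hU₁, hU₂, hp, hq, hU⟩ := isOpen_prod_iff.1 hW p₀ q₀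
    ⟨by simpa [hr₀] using hmem, by rw [hD₀]; positivity⟩
  have hind₁ : AlgebraicIndependent ℚ ![t] :=
    algebraicIndependent_unique_type_iff.2 (by simpa using ht)
  obtain ⟨q, hqi, hqU⟩ := (dense_setOf_algebraicIndependent_cons hind₁).exists_mem_open hU₂ ⟨q₀, hq⟩
  obtain ⟨p, hpi, hpU⟩ := (dense_setOf_algebraicIndependent_cons hqi).exists_mem_open hU₁ ⟨p₀, hp⟩
  obtain ⟨hpV, hDpos⟩ := hU (Set.mk_mem_prod hpU hqU)
  have hsq : √(D (p, q)) ^ 2 = D (p, q) := Real.sq_sqrt hDpos.le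
  have heq : p ^ 2 + q ^ 2 + r (p, q) ^ 2 - p * q * r (p, q) - 2 = t := by
    have h1 : r (p, q) ^ 2 - p * q * r (p, q) = (σ ^ 2 * √(D (p, q)) ^ 2 - (p * q) ^ 2) / 4 := by
      simp only [r]; ring
    rw [hσ, hsq] at h1
    simp only [D] at h1
    linarith
  have htpq : AlgebraicIndependent ℚ (Fin.cons t ![p, q] : Fin 3 → ℝ) := by
    convert hpi.comp ![2, 0, 1] (by decide) using 1
    funext i
    fin_cases i <;> rfl
  refine ⟨p, q, r (p, q), hpV, heq, htpq.cons_of_isAlgebraic_imp fun hb => ?_⟩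
  have hpa := isAlgebraic_adjoin_of_mem (s := Set.range ![p, q]) ⟨0, rfl⟩
  have hqa := isAlgebraic_adjoin_of_mem (s := Set.range ![p, q]) ⟨1, rfl⟩
  simp only [Matrix.cons_val_zero, Matrix.cons_val_one] at hpa hqa
  rw [← heq]
  exact ((((hpa.pow 2).add (hqa.pow 2)).add (hb.pow 2)).sub ((hpa.mul hqa).mul hb)).sub
    (isAlgebraic_natCast 2)

lemma algebraicIndependent_zetaOf {x y z : ℝ} (hz : 2 < z)
    (h : AlgebraicIndependent ℚ ![z, x, y]) : AlgebraicIndependent ℚ ![zetaOf z, x, y] := by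
  refine AlgebraicIndependent.cons_of_isAlgebraic_imp (v := ![x, y]) h fun hb => ?_
  rw [← zetaOf_add_inv hz]
  exact hb.add hb.inv

lemma trSL_conj (g h : SL2R) : trSL (g * h * g⁻¹) = trSL h := by
  rw [trSL, Matrix.SpecialLinearGroup.coe_mul, Matrix.trace_mul_comm,
    ← Matrix.SpecialLinearGroup.coe_mul, inv_mul_cancel_left, trSL]

lemma trace_prod_letterMat_eq_trSL (ξ : ℝ × ℝ × ℝ) (L : List (Bool × Bool)) :
    (L.map (letterMat ξ.1 ξ.2.1 (zetaOf ξ.2.2))).prod.trace =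
      trSL (rho ξ (FreeGroup.mk L)) * (L.map (letterScale (zetaOf ξ.2.2))).prod := by
  obtain ⟨x, y, z⟩ := ξ
  have h0 := zetaOf_ne_zero z
  have h := mul_prod_map_of_intertwine 1 (letterMat x y (zetaOf z))
    (fun a => ((cond a.2 (if a.1 then Amat x else Bmat y z)
      (if a.1 then Amat x else Bmat y z)⁻¹ : SL2R) : Matrix (Fin 2) (Fin 2) ℝ))
    (letterScale (zetaOf z)) (by
      rintro ⟨_ | _, _ | _⟩ <;> dsimp only [cond] <;>
        simp only [Bool.false_eq_true, if_true, if_false, Matrix.SpecialLinearGroup.coe_inv] <;>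
        ext i j <;> fin_cases i <;> fin_cases j <;>
        simp [letterMat, letterScale, Amat, Bmat, Matrix.adjugate_fin_two] <;> field_simp) L
  rw [one_mul, mul_one] at h
  rw [h, Matrix.trace_smul, smul_eq_mul, mul_comm]
  congr 1
  rw [trSL, rho, ev, FreeGroup.lift_mk]
  congr 1
  rw [← Matrix.SpecialLinearGroup.coeMonoidHom_apply, map_list_prod, List.map_map]
  rfl

lemma FreeGroup.exists_conj_isCyclicallyReduced {α : Type*} [DecidableEq α] {w : FreeGroup α}
    (hw : w ≠ 1) : ∃ (g : FreeGroup α) (L : List (α × Bool)), L ≠ [] ∧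
      FreeGroup.IsCyclicallyReduced L ∧ w = g * FreeGroup.mk L * g⁻¹ := by
  refine ⟨.mk (FreeGroup.reduceCyclically.conjugator w.toWord),
    FreeGroup.reduceCyclically w.toWord, ?_, ?_, ?_⟩
  · intro h
    have h' := FreeGroup.reduceCyclically.conj_conjugator_reduceCyclically w.toWord
    apply hw
    rw [← FreeGroup.mk_toWord (x := w), ← h', h, List.append_nil, ← FreeGroup.mul_mk,
      ← FreeGroup.inv_mk, mul_inv_cancel]
  · exact FreeGroup.reduceCyclically.isCyclicallyReduced FreeGroup.isReduced_toWord
  · rw [FreeGroup.inv_mk, FreeGroup.mul_mk, FreeGroup.mul_mk,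
      FreeGroup.reduceCyclically.conj_conjugator_reduceCyclically, FreeGroup.mk_toWord]

/-- If `cos θ` is transcendental, `w ≠ 1` and `c` is algebraic, then
`{ξ ∈ 𝔠_θ : tr w(A_ξ,B_ξ) = c}` has empty interior in `𝔠_θ`. -/
theorem stmt_1 (θ : ℝ) (hθ : θ ∈ Set.Ioo 0 (2 * Real.pi))
    (htrans : Transcendental ℚ (Real.cos θ))
    (w : F2) (hw : w ≠ 1) (c : ℝ) (hc : IsAlgebraic ℚ c) :
    interior {ξ : ↥(FK θ) | trSL (rho ξ.1 w) = c} = ∅ := by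
  rw [Set.eq_empty_iff_forall_notMem]
  rintro ⟨⟨x₀, y₀, z₀⟩, hx₀, hy₀, hz₀, h₀⟩ hmem
  dsimp only at hx₀ hy₀ hz₀ h₀
  obtain ⟨S, hS, hSo, hξS⟩ := mem_interior.1 hmem
  obtain ⟨V, hV, rfl⟩ := isOpen_induced_iff.1 hSo
  have ht : Transcendental ℚ (-2 * Real.cos (θ / 2)) := by
    intro halg
    apply htrans
    have : Real.cos θ = (-2 * Real.cos (θ / 2)) ^ 2 / 2 - 1 := by
      rw [show θ = 2 * (θ / 2) by ring, Real.cos_two_mul]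
      ring_nf
    rw [this, div_eq_mul_inv]
    exact ((halg.pow 2).mul (isAlgebraic_natCast 2).inv).sub isAlgebraic_one
  have hQ : IsOpen (V ∩ {p : ℝ × ℝ × ℝ | 2 < p.1 ∧ 2 < p.2.1 ∧ 2 < p.2.2}) := by
    simp only [Set.ofPred_and]
    refine hV.inter ((isOpen_lt ?_ ?_).inter ((isOpen_lt ?_ ?_).inter (isOpen_lt ?_ ?_))) <;>
      fun_prop
  have hQ₀ : (x₀, y₀, z₀) ∈ V ∩ {p : ℝ × ℝ × ℝ | 2 < p.1 ∧ 2 < p.2.1 ∧ 2 < p.2.2} :=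
    ⟨hξS, hx₀, hy₀, hz₀⟩
  obtain ⟨x, y, z, ⟨hxyzV, hx, hy, hz⟩, heq, hind⟩ : ∃ x y z : ℝ,
      (x, y, z) ∈ V ∩ {p : ℝ × ℝ × ℝ | 2 < p.1 ∧ 2 < p.2.1 ∧ 2 < p.2.2} ∧
      x ^ 2 + y ^ 2 + z ^ 2 - x * y * z - 2 = -2 * Real.cos (θ / 2) ∧
      AlgebraicIndependent ℚ ![z, x, y] := by
    by_cases hne : 2 * z₀ - x₀ * y₀ = 0
    · have hne' : 2 * x₀ - y₀ * z₀ ≠ 0 := by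
        intro h
        nlinarith
      obtain ⟨y, z, x, hm, heq, hind⟩ := exists_algebraicIndependent_mem ht
        (by linarith : y₀ ^ 2 + z₀ ^ 2 + x₀ ^ 2 - y₀ * z₀ * x₀ - 2 = _) hne'
        (hQ.preimage (by fun_prop : Continuous fun u : ℝ × ℝ × ℝ => (u.2.2, u.1, u.2.1))) hQ₀
      refine ⟨x, y, z, hm, by linarith, ?_⟩
      convert hind.comp ![2, 0, 1] (by decide) using 1
      funext i
      fin_cases i <;> rfl
    · exact exists_algebraicIndependent_mem ht h₀ hne hQ hQ₀
  obtain ⟨g, L, hLne, hL, rfl⟩ := FreeGroup.exists_conj_isCyclicallyReduced hw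
  have htr : trSL (rho (x, y, z) (g * FreeGroup.mk L * g⁻¹)) = c :=
    @hS ⟨(x, y, z), hx, hy, hz, heq⟩ hxyzV
  rw [map_mul, map_mul, map_inv, trSL_conj] at htr
  refine trace_prod_letterMat_ne_of_algebraicIndependent hLne hL hc
    (algebraicIndependent_zetaOf hz hind) ?_
  rw [trace_prod_letterMat_eq_trSL (x, y, z), htr]
end

section
/- Let w ∈ F₂ with w ≠ 1, and let g ∈ ℤ[x,y,z] be any polynomial in three variables with integer coefficients satisfying the trace identity tr(w(A,B)) = g(tr A, tr B, tr(AB)) for all A, B ∈ SL(2,ℝ). Then g is not a constant polynomial; equivalently, there exist A, B ∈ SL(2,ℝ) with tr(w(A,B)) ≠ 2. -/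
section LeadingTerm

open Matrix

/-- A column vector attached to each letter of the alphabet `X, X⁻¹, Y, Y⁻¹`. -/
def letterCol : Bool × Bool → Fin 2 → ℝ
  | (true, true) => ![1, 0]
  | (true, false) => ![0, 1]
  | (false, true) => ![2, 1]
  | (false, false) => ![1, 1]

/-- A row vector attached to each letter, vanishing on the column of another letter exactly when
the two letters are mutually inverse. -/
def letterRow : Bool × Bool → Fin 2 → ℝ
  | (true, true) => ![1, 0]
  | (true, false) => ![0, 1]
  | (false, true) => ![1, -1]
  | (false, false) => ![-1, 2]

/-- The rank-one projection attached to a letter. -/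
def letterProj (a : Bool × Bool) : Matrix (Fin 2) (Fin 2) ℝ :=
  vecMulVec (letterCol a) (letterRow a)

lemma letterRow_dotProduct_letterCol_ne_zero (a b : Bool × Bool) (h : a.1 = b.1 → a.2 = b.2) :
    letterRow a ⬝ᵥ letterCol b ≠ 0 := by
  rcases a with ⟨_ | _, _ | _⟩ <;> rcases b with ⟨_ | _, _ | _⟩ <;>
    simp [letterRow, letterCol, dotProduct, Fin.sum_univ_two] at h ⊢ <;> norm_num

lemma exists_prod_letterProj_eq_smul (L : List (Bool × Bool)) (a : Bool × Bool)
    (h : FreeGroup.IsReduced (a :: L)) :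
    ∃ c : ℝ, c ≠ 0 ∧ ((a :: L).map letterProj).prod =
      c • vecMulVec (letterCol a) (letterRow ((a :: L).getLast (by simp))) := by
  induction L generalizing a with
  | nil => exact ⟨1, one_ne_zero, by simp [letterProj]⟩
  | cons b L ih =>
    rw [FreeGroup.isReduced_cons_cons] at h
    obtain ⟨c, hc, hprod⟩ := ih b h.2
    refine ⟨c * (letterRow a ⬝ᵥ letterCol b),
      mul_ne_zero hc (letterRow_dotProduct_letterCol_ne_zero a b h.1), ?_⟩
    rw [List.map_cons, List.prod_cons, hprod, letterProj, mul_smul_comm,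
      vecMulVec_mul_vecMulVec, List.getLast_cons (List.cons_ne_nil b L), vecMulVec_smul, mul_smul]

lemma trace_prod_letterProj_ne_zero {L : List (Bool × Bool)} (hL : L ≠ [])
    (h : FreeGroup.IsCyclicallyReduced L) : (L.map letterProj).prod.trace ≠ 0 := by
  obtain ⟨a, L, rfl⟩ := List.exists_cons_of_ne_nil hL
  obtain ⟨c, hc, hprod⟩ := exists_prod_letterProj_eq_smul L a h.isReduced
  rw [hprod, trace_smul, trace_vecMulVec, smul_eq_mul, dotProduct_comm]
  refine mul_ne_zero hc (letterRow_dotProduct_letterCol_ne_zero _ _ ?_)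
  exact h.2 _ (by simp [List.getLast?_eq_some_getLast]) _ (by simp)

/-- The hyperbolic element with eigenvalues `u⁻¹` and `u` whose eigenprojections are those of the
generator indexed by `b` and its inverse. -/
noncomputable def hyperbolicGen (u : ℝ) (hu : u ≠ 0) (b : Bool) : SL2R :=
  ⟨u⁻¹ • letterProj (b, true) + u • letterProj (b, false), by
    cases b
    · simp [letterProj, letterCol, letterRow, det_fin_two]
      field_simp
      ring
    · simp [letterProj, letterCol, letterRow, det_fin_two, hu]⟩

lemma smul_hyperbolicGen (u : ℝ) (hu : u ≠ 0) (a : Bool × Bool) :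
    u • ((cond a.2 (hyperbolicGen u hu a.1) (hyperbolicGen u hu a.1)⁻¹ : SL2R) :
      Matrix (Fin 2) (Fin 2) ℝ) = letterProj a + u ^ 2 • letterProj (a.1, !a.2) := by
  have hinv : ∀ C : SL2R, (C⁻¹ : SL2R).1 = adjugate C.1 := fun _ => rfl
  rcases a with ⟨_ | _, _ | _⟩ <;> simp only [cond_true, cond_false, hinv] <;> ext i j <;>
    fin_cases i <;> fin_cases j <;>
    simp [hyperbolicGen, letterProj, letterCol, letterRow, adjugate_fin_two] <;>
    field_simp <;> ring

lemma coe_mul_SL2R (C D : SL2R) : (C * D).1 = C.1 * D.1 := rfl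

lemma smul_prod_hyperbolicGen (u : ℝ) (hu : u ≠ 0) (L : List (Bool × Bool)) :
    u ^ L.length • ((L.map fun a => cond a.2 (hyperbolicGen u hu a.1)
      (hyperbolicGen u hu a.1)⁻¹).prod : Matrix (Fin 2) (Fin 2) ℝ) =
    (L.map fun a => letterProj a + u ^ 2 • letterProj (a.1, !a.2)).prod := by
  induction L with
  | nil => simp
  | cons a L ih =>
    rw [List.map_cons, List.prod_cons, List.map_cons, List.prod_cons, ← ih,
      ← smul_hyperbolicGen u hu a, coe_mul_SL2R, smul_mul_smul_comm,
      List.length_cons, pow_succ']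

lemma continuous_prod_letterProj_add (L : List (Bool × Bool)) :
    Continuous fun u : ℝ =>
      (L.map fun a => letterProj a + u ^ 2 • letterProj (a.1, !a.2)).prod := by
  induction L with
  | nil => simpa using continuous_const
  | cons a L ih =>
    simp only [List.map_cons, List.prod_cons]
    exact Continuous.mul (by fun_prop) ih

lemma exists_trSL_ev_mk_ne_two {L : List (Bool × Bool)} (hL : L ≠ [])
    (h : FreeGroup.IsCyclicallyReduced L) : ∃ A B : SL2R, trSL (ev A B (FreeGroup.mk L)) ≠ 2 := by
  by_contra! htr
  let F : ℝ → ℝ := fun u =>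
    (L.map fun a => letterProj a + u ^ 2 • letterProj (a.1, !a.2)).prod.trace
  have hF : Continuous F := (continuous_prod_letterProj_add L).matrix_trace
  have hne : Set.EqOn F (fun u => u ^ L.length * 2) {0}ᶜ := by
    intro u hu
    have hgen : (fun b => if b then hyperbolicGen u hu true else hyperbolicGen u hu false) =
        hyperbolicGen u hu := by
      funext b
      cases b <;> rfl
    have := htr (hyperbolicGen u hu true) (hyperbolicGen u hu false)
    rw [ev, hgen, FreeGroup.lift_mk, trSL] at this
    simp only [F]
    rw [← smul_prod_hyperbolicGen u hu L, trace_smul, this, smul_eq_mul]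
  have hzero := congrFun (hF.ext_on (dense_compl_singleton 0) (by fun_prop) hne) 0
  have hlen : L.length ≠ 0 := by simpa using hL
  exact trace_prod_letterProj_ne_zero hL h (by simpa [F, hlen] using hzero)

lemma trSL_mul_mul_inv (C D : SL2R) : trSL (C * D * C⁻¹) = trSL D := by
  rw [trSL, coe_mul_SL2R, trace_mul_comm, ← coe_mul_SL2R,
    inv_mul_cancel_left, trSL]

lemma exists_trSL_ev_ne_two {w : F2} (hw : w ≠ 1) : ∃ A B : SL2R, trSL (ev A B w) ≠ 2 := by
  have hconj : w = FreeGroup.mk (FreeGroup.reduceCyclically.conjugator w.toWord) *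
      FreeGroup.mk (FreeGroup.reduceCyclically w.toWord) *
      (FreeGroup.mk (FreeGroup.reduceCyclically.conjugator w.toWord))⁻¹ := by
    rw [FreeGroup.inv_mk, FreeGroup.mul_mk, FreeGroup.mul_mk,
      FreeGroup.reduceCyclically.conj_conjugator_reduceCyclically, FreeGroup.mk_toWord]
  have hL : FreeGroup.reduceCyclically w.toWord ≠ [] := by
    intro hnil
    rw [hnil, ← FreeGroup.one_eq_mk, mul_one, mul_inv_cancel] at hconj
    exact hw hconj
  obtain ⟨A, B, hAB⟩ := exists_trSL_ev_mk_ne_two hL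
    (FreeGroup.reduceCyclically.isCyclicallyReduced FreeGroup.isReduced_toWord)
  refine ⟨A, B, ?_⟩
  rwa [hconj, map_mul, map_mul, map_inv, trSL_mul_mul_inv]

end LeadingTerm

/-- A trace polynomial of a nontrivial word is nonconstant; equivalently,
there are `A, B ∈ SL(2,ℝ)` with `tr w(A,B) ≠ 2`. -/
theorem stmt_5 (w : F2) (hw : w ≠ 1) (g : MvPolynomial (Fin 3) ℤ)
    (hg : ∀ A B : SL2R,
      trSL (ev A B w) =
        MvPolynomial.aeval ![trSL A, trSL B, trSL (A * B)] g) :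
    (∀ c : ℤ, g ≠ MvPolynomial.C c) ∧
    ∃ A B : SL2R, trSL (ev A B w) ≠ 2 := by
  have hexists := exists_trSL_ev_ne_two hw
  refine ⟨?_, hexists⟩
  rintro c rfl
  obtain ⟨A, B, hAB⟩ := hexists
  have hone : ev 1 1 = 1 := by
    ext b
    cases b <;> simp [ev]
  have htwo := hg 1 1
  rw [hone, MonoidHom.one_apply, MvPolynomial.aeval_C] at htwo
  apply hAB
  rw [hg A B, MvPolynomial.aeval_C, ← htwo]
  simp [trSL]
end

section
/- A word u ∈ F₂ is palindromic if and only if it is a product of two involutions in W with one of the two being P, Q, or R; precisely, u is palindromic if and only if there exist J ∈ {P, Q, R} and w ∈ W with w² = 1 such that ι(u) = J·w. -/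
/-- Relators of the free Coxeter group `W = ℤ₂ * ℤ₂ * ℤ₂`. -/
def coxRels : Set (FreeGroup (Fin 3)) :=
  {FreeGroup.of 0 ^ 2, FreeGroup.of 1 ^ 2, FreeGroup.of 2 ^ 2}

/-- The free Coxeter group `W = ⟨P, Q, R ∣ P² = Q² = R² = 1⟩`. -/
abbrev W := PresentedGroup coxRels

/-- The generator `P` of `W`. -/
def Pg : W := PresentedGroup.of 0

/-- The generator `Q` of `W`. -/
def Qg : W := PresentedGroup.of 1

/-- The generator `R` of `W`. -/
def Rg : W := PresentedGroup.of 2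

/-- The embedding `ι : F₂ → W`, `X ↦ QR`, `Y ↦ RP`. -/
def iota : F2 →* W := FreeGroup.lift (fun b => if b then Qg * Rg else Rg * Pg)

/-- The automorphism of `F₂` inverting `X` and `Y`. -/
def sigXY : F2 →* F2 := FreeGroup.lift (fun b => (FreeGroup.of b)⁻¹)

/-- The endomorphism of `F₂` inverting `Y` and `Z = (XY)⁻¹`
(it sends `X ↦ Y⁻¹X⁻¹Y` and `Y ↦ Y⁻¹`, hence `Z ↦ Z⁻¹`). -/
def sigYZ : F2 →* F2 := FreeGroup.lift (fun b => if b then Yg⁻¹ * Xg⁻¹ * Yg else Yg⁻¹)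

/-- The endomorphism of `F₂` inverting `Z = (XY)⁻¹` and `X`
(it sends `X ↦ X⁻¹` and `Y ↦ XY⁻¹X⁻¹`, hence `Z ↦ Z⁻¹`). -/
def sigZX : F2 →* F2 := FreeGroup.lift (fun b => if b then Xg⁻¹ else Xg * Yg⁻¹ * Xg⁻¹)

/-- A word `u ∈ F₂` is palindromic if one of the three inversions sends it to `u⁻¹`. -/
def Palindromic (u : F2) : Prop := sigXY u = u⁻¹ ∨ sigYZ u = u⁻¹ ∨ sigZX u = u⁻¹

lemma Pg_mul_self : Pg * Pg = 1 := by
  have h : PresentedGroup.mk coxRels (FreeGroup.of 0 ^ 2) = 1 :=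
    PresentedGroup.one_of_mem (by simp [coxRels])
  rwa [map_pow, pow_two] at h

lemma Qg_mul_self : Qg * Qg = 1 := by
  have h : PresentedGroup.mk coxRels (FreeGroup.of 1 ^ 2) = 1 :=
    PresentedGroup.one_of_mem (by simp [coxRels])
  rwa [map_pow, pow_two] at h

lemma Rg_mul_self : Rg * Rg = 1 := by
  have h : PresentedGroup.mk coxRels (FreeGroup.of 2 ^ 2) = 1 :=
    PresentedGroup.one_of_mem (by simp [coxRels])
  rwa [map_pow, pow_two] at h

lemma sigXY_sigXY (u : F2) : sigXY (sigXY u) = u := by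
  have h : sigXY.comp sigXY = MonoidHom.id F2 := by
    ext b
    simp [sigXY]
  exact DFunLike.congr_fun h u

/-- The involutions of the set `F₂` by which `P`, `Q`, `R` act. -/
def coxPerm (i : Fin 3) : Equiv.Perm F2 :=
  Function.Involutive.toPerm (fun u => ![Yg⁻¹, Xg, 1] i * sigXY u) (by
    intro u
    fin_cases i <;> simp [sigXY_sigXY] <;> simp [sigXY, Xg, Yg])

lemma coxPerm_mul_self (i : Fin 3) : coxPerm i * coxPerm i = 1 := by
  ext1 u
  exact (coxPerm i).left_inv u

/-- The action of `W` on the set `F₂` extending left translation along `ι`. -/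
def coxAction : W →* Equiv.Perm F2 :=
  PresentedGroup.toGroup (f := coxPerm) (by
    rintro r (rfl | rfl | rfl) <;> simp [pow_two, coxPerm_mul_self])

lemma coxAction_iota (u : F2) : coxAction (iota u) = MulAction.toPermHom F2 F2 u := by
  have h : coxAction.comp iota = MulAction.toPermHom F2 F2 := by
    ext b v
    cases b <;>
      simp [iota, coxAction, Pg, Qg, Rg, coxPerm, sigXY_sigXY] <;>
      simp [sigXY, Xg, Yg]
  exact DFunLike.congr_fun h u

lemma iota_injective : Function.Injective iota := by
  intro u v h
  have := congrArg (fun w => coxAction w 1) h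
  simpa [coxAction_iota] using this

lemma inv_eq_self_of_mul_self {G : Type*} [Group G] {g : G} (h : g * g = 1) : g⁻¹ = g :=
  inv_eq_of_mul_eq_one_left h

lemma mul_self_mul_cancel {G : Type*} [Group G] {g : G} (h : g * g = 1) (a : G) :
    g * (g * a) = a := by
  rw [← mul_assoc, h, one_mul]

lemma iota_sigXY (u : F2) : iota (sigXY u) = Rg * iota u * Rg := by
  have hR := inv_eq_self_of_mul_self Rg_mul_self
  have hP := inv_eq_self_of_mul_self Pg_mul_self
  have hQ := inv_eq_self_of_mul_self Qg_mul_self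
  have h : iota.comp sigXY = (MulAut.conj Rg).toMonoidHom.comp iota := by
    ext b
    cases b <;>
      simp [sigXY, iota, hP, hQ, hR, mul_assoc, Rg_mul_self, mul_self_mul_cancel Rg_mul_self]
  simpa [hR] using DFunLike.congr_fun h u

lemma iota_sigYZ (u : F2) : iota (sigYZ u) = Pg * iota u * Pg := by
  have hR := inv_eq_self_of_mul_self Rg_mul_self
  have hP := inv_eq_self_of_mul_self Pg_mul_self
  have hQ := inv_eq_self_of_mul_self Qg_mul_self
  have h : iota.comp sigYZ = (MulAut.conj Pg).toMonoidHom.comp iota := by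
    ext b
    cases b <;>
      simp [sigYZ, Xg, Yg, iota, hP, hQ, hR, mul_assoc, Pg_mul_self,
        mul_self_mul_cancel Rg_mul_self]
  simpa [hP] using DFunLike.congr_fun h u

lemma iota_sigZX (u : F2) : iota (sigZX u) = Qg * iota u * Qg := by
  have hR := inv_eq_self_of_mul_self Rg_mul_self
  have hP := inv_eq_self_of_mul_self Pg_mul_self
  have hQ := inv_eq_self_of_mul_self Qg_mul_self
  have h : iota.comp sigZX = (MulAut.conj Qg).toMonoidHom.comp iota := by
    ext b
    cases b <;>
      simp [sigZX, Xg, Yg, iota, hP, hQ, hR, mul_assoc,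
        mul_self_mul_cancel Rg_mul_self, mul_self_mul_cancel Qg_mul_self]
  simpa [hQ] using DFunLike.congr_fun h u

lemma conj_eq_inv_iff_exists_sq_eq_one {G : Type*} [Group G] {J g : G} (hJ : J * J = 1) :
    J * g * J = g⁻¹ ↔ ∃ w : G, w ^ 2 = 1 ∧ g = J * w := by
  rw [eq_inv_iff_mul_eq_one]
  constructor
  · intro h
    refine ⟨J * g, ?_, ?_⟩
    · rw [pow_two, ← mul_assoc, h]
    · rw [← mul_assoc, hJ, one_mul]
  · rintro ⟨w, hw, rfl⟩
    rw [← mul_assoc J J w, hJ, one_mul, mul_assoc w J, ← mul_assoc J J w, hJ, one_mul, ← pow_two,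
      hw]

/-- A word `u ∈ F₂` is palindromic iff `ι(u)` is a product `J·w` of two
involutions in `W` with `J ∈ {P,Q,R}`. -/
theorem stmt_7 (u : F2) :
    Palindromic u ↔
      ∃ J ∈ ({Pg, Qg, Rg} : Set W), ∃ w : W, w ^ 2 = 1 ∧ iota u = J * w := by
  simp only [Palindromic, ← iota_injective.eq_iff, map_inv, iota_sigXY, iota_sigYZ, iota_sigZX,
    conj_eq_inv_iff_exists_sq_eq_one Pg_mul_self, conj_eq_inv_iff_exists_sq_eq_one Qg_mul_self,
    conj_eq_inv_iff_exists_sq_eq_one Rg_mul_self, Set.mem_insert_iff, Set.mem_singleton_iff,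
    exists_eq_or_imp, exists_eq_left]
  exact or_comm.trans or_assoc
end

section
/- Let G be a group and let φ : W → G be a group homomorphism such that the composition φ ∘ ι : F₂ → G is injective. Then φ is injective. -/
lemma coxGen_mul_self (i : Fin 3) :
    (PresentedGroup.of i : W) * PresentedGroup.of i = 1 := by
  have hi : FreeGroup.of i ^ 2 ∈ coxRels := by
    fin_cases i <;> simp [coxRels]
  have h := PresentedGroup.one_of_mem hi
  rwa [map_pow, pow_two] at h

lemma iota_Xg : iota Xg = Qg * Rg := by
  simp [iota, Xg]

lemma iota_Yg : iota Yg = Rg * Pg := by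
  simp [iota, Yg]

lemma Pg_inv : Pg⁻¹ = Pg := inv_eq_of_mul_eq_one_left Pg_mul_self

lemma Qg_inv : Qg⁻¹ = Qg := inv_eq_of_mul_eq_one_left Qg_mul_self

lemma Rg_inv : Rg⁻¹ = Rg := inv_eq_of_mul_eq_one_left Rg_mul_self

/-- The cosets of the image of `ι` represented by `1` and `R` are stable under right
multiplication by a generator of `W`. -/
lemma exists_iota_mul_coxGen (u : F2) (i : Fin 3) :
    (∃ v, iota u * PresentedGroup.of i = iota v * Rg) ∧
      ∃ v, iota u * Rg * PresentedGroup.of i = iota v := by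
  fin_cases i
  · refine ⟨⟨u * Yg⁻¹, ?_⟩, ⟨u * Yg, ?_⟩⟩
    · change iota u * Pg = _
      simp [iota_Yg, Pg_inv, mul_assoc]
    · change iota u * Rg * Pg = _
      simp [iota_Yg, mul_assoc]
  · refine ⟨⟨u * Xg, ?_⟩, ⟨u * Xg⁻¹, ?_⟩⟩
    · change iota u * Qg = _
      simp [iota_Xg, Rg_mul_self, mul_assoc]
    · change iota u * Rg * Qg = _
      simp [iota_Xg, Qg_inv, Rg_inv, mul_assoc]
  · refine ⟨⟨u, rfl⟩, ⟨u, ?_⟩⟩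
    change iota u * Rg * Rg = _
    simp [Rg_mul_self, mul_assoc]

/-- The image of `ι` has index at most two in `W`, with coset representatives `1` and `R`. -/
lemma exists_eq_iota_or_eq_iota_mul_Rg (w : W) :
    ∃ u, w = iota u ∨ w = iota u * Rg := by
  have hw : w ∈ Subgroup.closure (Set.range (PresentedGroup.of : Fin 3 → W)) := by
    rw [PresentedGroup.closure_range_of]
    trivial
  have step (x : W) (i : Fin 3) (hx : ∃ u, x = iota u ∨ x = iota u * Rg) :
      ∃ u, x * PresentedGroup.of i = iota u ∨ x * PresentedGroup.of i = iota u * Rg := by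
    obtain ⟨u, rfl | rfl⟩ := hx
    · exact (exists_iota_mul_coxGen u i).1.imp fun _ hv => Or.inr hv
    · exact (exists_iota_mul_coxGen u i).2.imp fun _ hv => Or.inl hv
  induction hw using Subgroup.closure_induction_right with
  | one => exact ⟨1, Or.inl (map_one iota).symm⟩
  | mul_right x _ y hy hx =>
    obtain ⟨i, rfl⟩ := hy
    exact step x i hx
  | mul_inv_cancel x _ y hy hx =>
    obtain ⟨i, rfl⟩ := hy
    rw [inv_eq_of_mul_eq_one_left (coxGen_mul_self i)]
    exact step x i hx

/-- Conjugation by `R` inverts `ι X`. -/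
lemma Rg_mul_iota_Xg_mul_Rg : Rg * iota Xg * Rg = iota Xg⁻¹ := by
  simp [iota_Xg, Qg_inv, Rg_inv, Rg_mul_self, mul_assoc]

/-- The generator `X` is not conjugate to its inverse in `F₂`. -/
lemma conj_Xg_ne_inv (u : F2) : u * Xg⁻¹ * u⁻¹ ≠ Xg := by
  intro hu
  have h := congrArg (FreeGroup.lift fun _ : Bool => Multiplicative.ofAdd (1 : ℤ)) hu
  simp only [map_mul, map_inv, Xg, FreeGroup.lift_apply_of, mul_right_comm _ _ (_)⁻¹,
    mul_inv_cancel, one_mul] at h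
  exact absurd h (by decide)

/-- If `φ : W → G` is a homomorphism with `φ ∘ ι` injective, then `φ`
is injective. -/
theorem stmt_8 {G : Type*} [Group G] (φ : W →* G)
    (h : Function.Injective (φ.comp iota)) : Function.Injective φ := by
  rw [injective_iff_map_eq_one]
  intro w hw
  obtain ⟨u, rfl | rfl⟩ := exists_eq_iota_or_eq_iota_mul_Rg w
  · rw [(injective_iff_map_eq_one _).1 h u hw, map_one]
  · refine absurd (h ?_) (conj_Xg_ne_inv u)
    have hR : φ Rg = (φ (iota u))⁻¹ := by
      rw [map_mul] at hw
      exact eq_inv_of_mul_eq_one_right hw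
    have hR' : φ Rg = φ (iota u) := by
      rw [← Rg_inv, map_inv, hR, inv_inv]
    have hX := congrArg φ Rg_mul_iota_Xg_mul_Rg
    rw [map_mul, map_mul, hR'] at hX
    simp only [MonoidHom.comp_apply, map_mul, map_inv] at hX ⊢
    have hsq : φ (iota u) * φ (iota u) = 1 := by
      rw [← hR', ← map_mul, Rg_mul_self, map_one]
    rw [← hX, ← hR, hR']
    simp only [← mul_assoc, hsq, one_mul]
    rw [mul_assoc, hsq, mul_one]
end
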